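/- arXiv:1801.06815 — 2 statements merged into one kernel-verified Lean document; each statement's English description precedes it below -/
import Mathlib

section
/- For every n ≥ 1, the number of partitions of n having exactly one even part value (which may be repeated, all other parts being odd) equals the number of partitions of n in which exactly one part value occurs more than once (all other part values occurring exactly once). -/
namespace Nat.Partition

open Finset PowerSeries
open scoped PowerSeries.WithPiTopology

section GenFun

variable {R : Type*} [CommRing R] [TopologicalSpace R]

theorem tsum_smul_pow_succ_of_constantCoeff_eq_zero [T2Space R] [IsTopologicalRing R]
    (t : R) {y : R⟦X⟧} (hy : y.constantCoeff = 0) :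
    ∑' j : ℕ, t • y ^ (j + 1) = C t * y * ∑' j : ℕ, y ^ j := by
  rw [← (WithPiTopology.summable_pow_of_constantCoeff_eq_zero hy).tsum_mul_left]
  refine tsum_congr fun j ↦ ?_
  rw [smul_eq_C_mul]
  ring

theorem one_add_tsum_weight_repeated [T2Space R] [IsTopologicalRing R]
    (t : R) {y : R⟦X⟧} (hy : y.constantCoeff = 0) :
    1 + ∑' j : ℕ, (if 1 < j + 1 then t else 1) • y ^ (j + 1) =
      (1 + y) * (1 + ∑' j : ℕ, t • (y ^ 2) ^ (j + 1)) := by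
  have hy2 : (y ^ 2).constantCoeff = 0 := by simp [hy]
  have hs := WithPiTopology.summable_pow_of_constantCoeff_eq_zero hy
  have hG := WithPiTopology.tsum_pow_mul_one_sub_of_constantCoeff_eq_zero hy
  have hH := WithPiTopology.tsum_pow_mul_one_sub_of_constantCoeff_eq_zero hy2
  have key : ∑' j : ℕ, y ^ j = (1 + y) * ∑' j : ℕ, (y ^ 2) ^ j := by
    linear_combination ((1 + y) * ∑' j : ℕ, (y ^ 2) ^ j) * hG - (∑' j : ℕ, y ^ j) * hH
  have hshift (j : ℕ) : (if 1 < j + 1 + 1 then t else 1) • y ^ (j + 1 + 1) =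
      (C t * y ^ 2) * y ^ j := by
    rw [if_pos (by lia), smul_eq_C_mul]
    ring
  rw [tsum_smul_pow_succ_of_constantCoeff_eq_zero t hy2, tsum_eq_zero_add']
  · simp_rw [hshift]
    rw [hs.tsum_mul_left, key]
    simp
    ring
  · simp_rw [hshift]
    exact hs.mul_left _

theorem genFun_even_eq_mul [T2Space R] [IsTopologicalRing R] (t : R) :
    genFun (fun i _ ↦ if Even i then t else 1) =
      genFun (fun i _ ↦ if Even i then t else 0) *
        PowerSeries.mk fun n ↦ (#(restricted n (¬ 2 ∣ ·)) : R) := by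
  refine (hasProd_genFun _).unique ?_
  convert! (hasProd_genFun (fun i _ ↦ if Even i then t else 0)).mul
    (hasProd_powerSeriesMk_card_restricted R (¬ 2 ∣ ·)) using 2 with i
  by_cases h : Even (i + 1)
  · simp [h, h.two_dvd]
  · have h2 : ¬ 2 ∣ i + 1 := fun hd ↦ h (even_iff_two_dvd.mpr hd)
    have hX : ((X : R⟦X⟧) ^ (i + 1)).constantCoeff = 0 := by simp
    have hs := WithPiTopology.summable_pow_of_constantCoeff_eq_zero hX
    simp_rw [if_neg h, if_pos h2, pow_mul]
    rw [hs.tsum_eq_zero_add]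
    simp

theorem genFun_repeated_eq_mul [T2Space R] [IsTopologicalRing R] (t : R) :
    genFun (fun _ c ↦ if 1 < c then t else 1) =
      genFun (fun i _ ↦ if Even i then t else 0) *
        PowerSeries.mk fun n ↦ (#(countRestricted n 2) : R) := by
  have hinj : Function.Injective fun i : ℕ ↦ 2 * i + 1 := fun a b h ↦ by grind
  have hE := (hinj.hasProd_iff fun i hi ↦ by
    have h : ¬ Even (i + 1) := fun ⟨k, hk⟩ ↦ hi ⟨k - 1, by grind⟩
    simp [h]).mpr (hasProd_genFun (fun i _ ↦ if Even i then t else 0))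
  refine (hasProd_genFun _).unique ?_
  convert! hE.mul (hasProd_powerSeriesMk_card_countRestricted R two_pos) using 2 with i
  have hX : ((X : R⟦X⟧) ^ (i + 1)).constantCoeff = 0 := by simp
  have he : Even (2 * i + 1 + 1) := ⟨i + 1, by ring⟩
  have hexp : (X : R⟦X⟧) ^ (2 * i + 1 + 1) = (X ^ (i + 1)) ^ 2 := by ring
  simp_rw [Function.comp_apply, if_pos he, pow_mul, hexp]
  rw [one_add_tsum_weight_repeated t hX, mul_comm]
  simp [add_comm]

omit [TopologicalSpace R] in
theorem genFun_even_eq_genFun_repeated [NoZeroDivisors R] (t : R) :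
    genFun (fun i _ ↦ if Even i then t else 1) = genFun (fun _ c ↦ if 1 < c then t else 1) := by
  let _ : TopologicalSpace R := ⊥
  have _ : DiscreteTopology R := ⟨rfl⟩
  rw [genFun_even_eq_mul, genFun_repeated_eq_mul,
    powerSeriesMk_card_restricted_eq_powerSeriesMk_card_countRestricted R two_pos]

end GenFun

theorem coeff_coeff_genFun_ite (P : ℕ → ℕ → Prop) [∀ i c, Decidable (P i c)] (n k : ℕ) :
    ((genFun fun i c ↦ if P i c then (Polynomial.X : Polynomial ℤ) else 1).coeff n).coeff k =
      Nat.card {p : n.Partition //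
        #{i ∈ p.parts.toFinset | P i (p.parts.count i)} = k} := by
  rw [coeff_genFun, Polynomial.finsetSum_coeff, Nat.card_eq_fintype_card, Fintype.card_subtype,
    card_filter, Nat.cast_sum]
  refine sum_congr rfl fun p _ ↦ ?_
  rw [Finsupp.prod, Multiset.toFinsupp_support, ← prod_filter, prod_const, Polynomial.coeff_X_pow]
  push_cast
  exact if_congr eq_comm rfl rfl

/-- The number of distinct even part values and the number of distinct repeated part values are
equidistributed over the partitions of `n`. -/
theorem card_even_values_eq_card_repeated_values (n k : ℕ) :
    Nat.card {p : n.Partition // #{i ∈ p.parts.toFinset | Even i} = k} =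
      Nat.card {p : n.Partition // #{i ∈ p.parts.toFinset | 1 < p.parts.count i} = k} := by
  have hE := coeff_coeff_genFun_ite (fun i _ ↦ Even i) n k
  have hR := coeff_coeff_genFun_ite (fun _ c ↦ 1 < c) n k
  rw [genFun_even_eq_genFun_repeated, hR] at hE
  exact_mod_cast hE.symm

end Nat.Partition

/-- For `n ≥ 1`, the number of partitions of `n` having exactly one even part value
(possibly repeated, all other parts odd) equals the number of partitions of `n` in which
exactly one part value occurs more than once (all other part values occurring exactly once). -/
theorem one_even_eq_one_repeated (n : ℕ) (hn : 1 ≤ n) :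
    Nat.card {c : n.Partition //
      (c.parts.toFinset.filter (fun i => Even i)).card = 1} =
    Nat.card {c : n.Partition //
      (c.parts.toFinset.filter (fun i => 1 < c.parts.count i)).card = 1} :=
  Nat.Partition.card_even_values_eq_card_repeated_values n 1
end

section
/- For every n ≥ 1, conjugation of partitions restricts to a bijection from the set G_I'(n) of gap-free partitions of n whose smallest part is 1 and whose largest part is even onto the set of partitions of n into distinct parts with an even (and positive) number of parts; moreover, for each λ ∈ G_I'(n), the multiplicity of the largest part of λ equals the smallest part of the conjugate partition λ'. -/
/-- A multiset of parts is gap-free if the part values form a set of consecutive integers,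
i.e. every integer lying between two parts is itself a part. -/
def GapFree (μ : Multiset ℕ) : Prop :=
  ∀ p ∈ μ, ∀ q ∈ μ, ∀ r, p ≤ r → r ≤ q → r ∈ μ

/-- The multiset of parts of the conjugate partition: its parts are the numbers
`#{p ∈ μ | p ≥ i}` for `i ≥ 1`, zero values being discarded. -/
def conjParts (μ : Multiset ℕ) : Multiset ℕ :=
  ((Finset.Icc 1 μ.sum).val.map
    (fun i => Multiset.card (μ.filter (fun p => i ≤ p)))).filter (fun v => 0 < v)

/-- The number of parts of `μ` that are at least `i`. -/
def numGE (μ : Multiset ℕ) (i : ℕ) : ℕ := Multiset.card (μ.filter (fun p => i ≤ p))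

lemma conjParts_eq (μ : Multiset ℕ) :
    conjParts μ = ((Finset.Icc 1 μ.sum).val.map (numGE μ)).filter (fun v => 0 < v) := rfl

lemma numGE_cons (a : ℕ) (μ : Multiset ℕ) (i : ℕ) :
    numGE (a ::ₘ μ) i = numGE μ i + if i ≤ a then 1 else 0 := by
  unfold numGE
  split_ifs with h <;> simp [h]

lemma numGE_antitone (μ : Multiset ℕ) : Antitone (numGE μ) := by
  intro i j hij
  exact Multiset.card_le_card (Multiset.monotone_filter_right μ fun p hp => hij.trans hp)

lemma numGE_pos {μ : Multiset ℕ} {i : ℕ} : 0 < numGE μ i ↔ ∃ q ∈ μ, i ≤ q := by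
  simp [numGE, Multiset.card_pos_iff_exists_mem]

lemma numGE_eq_count_add (μ : Multiset ℕ) (i : ℕ) :
    numGE μ i = μ.count i + numGE μ (i + 1) := by
  induction μ using Multiset.induction with
  | empty => simp [numGE]
  | cons a s ih =>
    rw [numGE_cons, numGE_cons, Multiset.count_cons, ih]
    split_ifs <;> omega

lemma le_sum_of_numGE_pos {μ : Multiset ℕ} {i : ℕ} (h : 0 < numGE μ i) : i ≤ μ.sum := by
  obtain ⟨q, hq, hiq⟩ := numGE_pos.1 h
  exact hiq.trans (Multiset.le_sum_of_mem hq)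

lemma sum_numGE {μ : Multiset ℕ} {N : ℕ} (h : ∀ p ∈ μ, p ≤ N) :
    ∑ i ∈ Finset.Icc 1 N, numGE μ i = μ.sum := by
  induction μ using Multiset.induction with
  | empty => simp [numGE]
  | cons a s ih =>
    have ha : (Finset.Icc 1 N).filter (· ≤ a) = Finset.Icc 1 a := by
      have := h a (Multiset.mem_cons_self a s)
      ext i
      simp only [Finset.mem_filter, Finset.mem_Icc]
      omega
    simp only [numGE_cons, Finset.sum_add_distrib, Multiset.sum_cons]
    rw [ih fun p hp => h p (Multiset.mem_cons_of_mem hp), Finset.sum_boole, ha]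
    simp [add_comm]

lemma sum_filter_pos (s : Multiset ℕ) : (s.filter (fun v => 0 < v)).sum = s.sum := by
  induction s using Multiset.induction with
  | empty => simp
  | cons a s ih =>
    rcases Nat.eq_zero_or_pos a with rfl | h
    · simpa using ih
    · simpa [h] using ih

lemma sum_conjParts (μ : Multiset ℕ) : (conjParts μ).sum = μ.sum := by
  rw [conjParts_eq, sum_filter_pos]
  exact sum_numGE fun p hp => Multiset.le_sum_of_mem hp

lemma pos_of_mem_conjParts {μ : Multiset ℕ} {v : ℕ} (h : v ∈ conjParts μ) : 0 < v :=
  (Multiset.mem_filter.1 h).2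

lemma mem_conjParts {μ : Multiset ℕ} {v : ℕ} :
    v ∈ conjParts μ ↔ 0 < v ∧ ∃ i, 1 ≤ i ∧ numGE μ i = v := by
  rw [conjParts_eq, Multiset.mem_filter, Multiset.mem_map]
  constructor
  · rintro ⟨⟨i, hi, rfl⟩, hv⟩
    exact ⟨hv, i, (Finset.mem_Icc.1 hi).1, rfl⟩
  · rintro ⟨hv, i, hi, rfl⟩
    exact ⟨⟨i, Finset.mem_Icc.2 ⟨hi, le_sum_of_numGE_pos hv⟩, rfl⟩, hv⟩

lemma numGE_conjParts (μ : Multiset ℕ) {j : ℕ} (hj : 1 ≤ j) :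
    numGE (conjParts μ) j = ((Finset.Icc 1 μ.sum).filter (fun i => j ≤ numGE μ i)).card := by
  have : ∀ v, (j ≤ v ∧ 0 < v) ↔ j ≤ v := fun v => by omega
  rw [numGE, conjParts_eq, Multiset.filter_filter]
  simp only [this]
  rw [Multiset.filter_map, Multiset.card_map]
  rfl

/-- Column heights and row lengths of a Young diagram determine each other. -/
lemma le_numGE_conjParts_iff (μ : Multiset ℕ) {i j : ℕ} (hi : 1 ≤ i) (hj : 1 ≤ j) :
    i ≤ numGE (conjParts μ) j ↔ j ≤ numGE μ i := by
  rw [numGE_conjParts μ hj]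
  constructor
  · contrapose!
    intro h
    have hsub : (Finset.Icc 1 μ.sum).filter (fun i => j ≤ numGE μ i) ⊆ Finset.Icc 1 (i - 1) := by
      intro k hk
      rw [Finset.mem_filter, Finset.mem_Icc] at hk
      have : k < i := by
        by_contra! hik
        have := numGE_antitone μ hik
        omega
      rw [Finset.mem_Icc]
      omega
    have := Finset.card_le_card hsub
    rw [Nat.card_Icc] at this
    omega
  · intro h
    have hsub : Finset.Icc 1 i ⊆ (Finset.Icc 1 μ.sum).filter (fun i => j ≤ numGE μ i) := by
      intro k hk
      rw [Finset.mem_Icc] at hk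
      have h1 := numGE_antitone μ hk.2
      have h2 := le_sum_of_numGE_pos (μ := μ) (i := k) (by omega)
      rw [Finset.mem_filter, Finset.mem_Icc]
      omega
    simpa using Finset.card_le_card hsub

lemma eq_of_numGE_eq {μ ν : Multiset ℕ} (hμ : ∀ p ∈ μ, 0 < p) (hν : ∀ p ∈ ν, 0 < p)
    (h : ∀ i, 1 ≤ i → numGE μ i = numGE ν i) : μ = ν := by
  ext i
  rcases Nat.eq_zero_or_pos i with rfl | hi
  · rw [Multiset.count_eq_zero_of_notMem fun h0 => (hμ 0 h0).false,
      Multiset.count_eq_zero_of_notMem fun h0 => (hν 0 h0).false]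
  · have h1 := numGE_eq_count_add μ i
    have h2 := numGE_eq_count_add ν i
    have h3 := h i hi
    have h4 := h (i + 1) (by omega)
    omega

lemma conjParts_conjParts {μ : Multiset ℕ} (hμ : ∀ p ∈ μ, 0 < p) :
    conjParts (conjParts μ) = μ := by
  refine eq_of_numGE_eq (fun _ => pos_of_mem_conjParts) hμ fun i hi => ?_
  refine eq_of_forall_le_iff fun j => ?_
  rcases Nat.eq_zero_or_pos j with rfl | hj
  · simp
  · rw [le_numGE_conjParts_iff _ hj hi, le_numGE_conjParts_iff _ hi hj]

lemma card_eq_numGE_one {μ : Multiset ℕ} (hμ : ∀ p ∈ μ, 0 < p) :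
    Multiset.card μ = numGE μ 1 := by
  exact congrArg Multiset.card (Multiset.filter_eq_self.2 hμ).symm

lemma isGreatest_card_conjParts {μ : Multiset ℕ} (hμ : ∀ p ∈ μ, 0 < p) (h0 : μ ≠ 0) :
    IsGreatest {p | p ∈ μ} (Multiset.card (conjParts μ)) := by
  have key : ∀ i, 1 ≤ i → (i ≤ Multiset.card (conjParts μ) ↔ ∃ q ∈ μ, i ≤ q) := fun i hi => by
    rw [card_eq_numGE_one fun _ => pos_of_mem_conjParts, le_numGE_conjParts_iff _ hi le_rfl,
      ← numGE_pos, Nat.succ_le_iff]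
  have hub : ∀ p ∈ μ, p ≤ Multiset.card (conjParts μ) := fun p hp =>
    (key p (hμ p hp)).2 ⟨p, hp, le_rfl⟩
  obtain ⟨a, ha⟩ := Multiset.exists_mem_of_ne_zero h0
  obtain ⟨q, hq, hle⟩ := (key _ ((hμ a ha).trans_le (hub a ha))).1 le_rfl
  have : q = Multiset.card (conjParts μ) := le_antisymm (hub q hq) hle
  exact ⟨this ▸ hq, hub⟩

lemma gapFree_and_one_mem_iff {μ : Multiset ℕ} (hμ : ∀ p ∈ μ, 0 < p) (h0 : μ ≠ 0) :
    GapFree μ ∧ 1 ∈ μ ↔ ∀ i, 1 ≤ i → 0 < numGE μ i → i ∈ μ := by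
  constructor
  · rintro ⟨hg, h1⟩ i hi hpos
    obtain ⟨q, hq, hiq⟩ := numGE_pos.1 hpos
    exact hg 1 h1 q hq i hi hiq
  · intro h
    obtain ⟨a, ha⟩ := Multiset.exists_mem_of_ne_zero h0
    exact ⟨fun p hp q hq r hpr hrq => h r ((hμ p hp).trans_le hpr) (numGE_pos.2 ⟨q, hq, hrq⟩),
      h 1 le_rfl (numGE_pos.2 ⟨a, ha, hμ a ha⟩)⟩

lemma nodup_conjParts_iff (μ : Multiset ℕ) :
    (conjParts μ).Nodup ↔ ∀ i, 1 ≤ i → 0 < numGE μ i → i ∈ μ := by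
  rw [conjParts_eq, Multiset.filter_map,
    Multiset.nodup_map_iff_inj_on (Multiset.Nodup.filter _ (Finset.Icc 1 μ.sum).nodup)]
  have hmem : ∀ i, i ∈ (Finset.Icc 1 μ.sum).val.filter ((fun v => 0 < v) ∘ numGE μ) ↔
      1 ≤ i ∧ 0 < numGE μ i := fun i => by
    rw [Multiset.mem_filter, Finset.mem_val, Finset.mem_Icc]
    exact ⟨fun h => ⟨h.1.1, h.2⟩, fun h => ⟨⟨h.1, le_sum_of_numGE_pos h.2⟩, h.2⟩⟩
  simp only [hmem]
  constructor
  · intro h i hi hpos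
    by_contra hn
    have h1 := numGE_eq_count_add μ i
    rw [Multiset.count_eq_zero_of_notMem hn, zero_add] at h1
    have := h i ⟨hi, hpos⟩ (i + 1) ⟨by omega, h1 ▸ hpos⟩ h1
    omega
  · intro h
    have hlt : ∀ i j, 1 ≤ i → 0 < numGE μ i → i < j → numGE μ j < numGE μ i := by
      intro i j hi hpos hij
      have h1 := numGE_eq_count_add μ i
      have h2 := Multiset.count_pos.2 (h i hi hpos)
      have h3 := numGE_antitone μ (Nat.succ_le_of_lt hij)
      simp only [Nat.succ_eq_add_one] at h3
      omega
    rintro i ⟨hi, hip⟩ j ⟨hj, hjp⟩ hij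
    rcases lt_trichotomy i j with hlt' | rfl | hlt'
    · exact absurd hij (hlt i j hi hip hlt').ne'
    · rfl
    · exact absurd hij (hlt j i hj hjp hlt').ne

lemma isLeast_count_conjParts {μ : Multiset ℕ} {m : ℕ} (hm : IsGreatest {p | p ∈ μ} m)
    (hpos : 0 < m) : IsLeast {p | p ∈ conjParts μ} (μ.count m) := by
  have hzero : numGE μ (m + 1) = 0 := by
    by_contra hne
    obtain ⟨q, hq, hmq⟩ := numGE_pos.1 (Nat.pos_of_ne_zero hne)
    have := hm.2 hq
    omega
  have hcount : numGE μ m = μ.count m := by rw [numGE_eq_count_add, hzero, add_zero]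
  refine ⟨mem_conjParts.2 ⟨Multiset.count_pos.2 hm.1, m, hpos, hcount⟩, fun v hv => ?_⟩
  obtain ⟨hv, i, -, rfl⟩ := mem_conjParts.1 hv
  obtain ⟨q, hq, hiq⟩ := numGE_pos.1 hv
  exact hcount ▸ numGE_antitone μ (hiq.trans (hm.2 hq))

/-- The conjugate of a partition. -/
def conjPartition {n : ℕ} (c : n.Partition) : n.Partition where
  parts := conjParts c.parts
  parts_pos := pos_of_mem_conjParts
  parts_sum := (sum_conjParts _).trans c.parts_sum

lemma conjPartition_involutive (n : ℕ) : Function.Involutive (conjPartition (n := n)) :=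
  fun c => Nat.Partition.ext (conjParts_conjParts fun _ => c.parts_pos)

/-- For `n ≥ 1`, conjugation restricts to a bijection from the gap-free partitions of `n`
with smallest part `1` and even largest part onto the distinct partitions of `n` with an even
(and positive) number of parts; moreover the multiplicity of the largest part of `λ` equals
the smallest part of the conjugate `λ'`. -/
theorem conjugate_bijection_even (n : ℕ) (hn : 1 ≤ n) :
    ∃ e : {c : n.Partition //
            GapFree c.parts ∧ 1 ∈ c.parts ∧ Even (sSup {p | p ∈ c.parts})} ≃
          {c : n.Partition //
            c.parts.Nodup ∧ Even (Multiset.card c.parts) ∧ 0 < Multiset.card c.parts},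
      ∀ c, (e c).1.parts = conjParts c.1.parts ∧
        c.1.parts.count (sSup {p | p ∈ c.1.parts}) = sInf {p | p ∈ (e c).1.parts} := by
  have hne : ∀ c : n.Partition, c.parts ≠ 0 := fun c h => by
    have := c.parts_sum
    rw [h, Multiset.sum_zero] at this
    omega
  have hgreatest : ∀ c : n.Partition,
      IsGreatest {p | p ∈ c.parts} (Multiset.card (conjParts c.parts)) :=
    fun c => isGreatest_card_conjParts (fun _ => c.parts_pos) (hne c)
  have hiff : ∀ c : n.Partition,
      (GapFree c.parts ∧ 1 ∈ c.parts ∧ Even (sSup {p | p ∈ c.parts})) ↔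
        ((conjPartition c).parts.Nodup ∧ Even (Multiset.card (conjPartition c).parts) ∧
          0 < Multiset.card (conjPartition c).parts) := fun c => by
    have hnodup : GapFree c.parts ∧ 1 ∈ c.parts ↔ (conjPartition c).parts.Nodup :=
      (gapFree_and_one_mem_iff (fun _ => c.parts_pos) (hne c)).trans
        (nodup_conjParts_iff c.parts).symm
    rw [← and_assoc, hnodup, (hgreatest c).csSup_eq,
      and_iff_left (Multiset.card_pos.2 (hne (conjPartition c)))]
    rfl
  refine ⟨(conjPartition_involutive n).toPerm.subtypeEquiv hiff, fun c => ⟨rfl, ?_⟩⟩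
  have hg := hgreatest c.1
  rw [hg.csSup_eq]
  exact (isLeast_count_conjParts hg (c.1.parts_pos hg.1)).csInf_eq.symm
end
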